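/- For every natural number n, Σ_{k=0}^{n} (−1)^k C(n,k) C(n+k,k) H_k² equals (−1)^n (4H_n² − 2H_n^{⟨2⟩} + H_{n/2}^{⟨2⟩}) if n is even, and (−1)^n (4H_n² − 2H_n^{⟨2⟩} + H_{(n−1)/2}^{⟨2⟩}) if n is odd. -/

import Mathlib

open Finset

/-- Harmonic number `H_n = ∑_{k=1}^n 1/k`. -/
noncomputable def harm (n : ℕ) : ℝ := ∑ k ∈ Finset.range n, 1 / ((k : ℝ) + 1)

/-- Second-order harmonic number `H_n^{⟨2⟩} = ∑_{k=1}^n 1/k²`. -/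
noncomputable def harm2 (n : ℕ) : ℝ := ∑ k ∈ Finset.range n, 1 / ((k : ℝ) + 1) ^ 2

/-- The coefficient `(-1)^k C(n,k) C(n+k,k)` of the shifted Legendre polynomial. -/
noncomputable def legCoeff (n k : ℕ) : ℝ :=
  (-1 : ℝ) ^ k * (n.choose k : ℝ) * ((n + k).choose k : ℝ)

/-- The Legendre-type transform `∑ₖ (-1)^k C(n,k) C(n+k,k) f(k)` of a sequence. -/
noncomputable def legSum (f : ℕ → ℝ) (n : ℕ) : ℝ :=
  ∑ k ∈ Finset.range (n + 1), legCoeff n k * f k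

lemma legCoeff_zero_right (n : ℕ) : legCoeff n 0 = 1 := by simp [legCoeff]

lemma legCoeff_eq_zero {n k : ℕ} (h : n < k) : legCoeff n k = 0 := by
  simp [legCoeff, Nat.choose_eq_zero_of_lt h]

lemma legCoeff_eq_factorial {n k : ℕ} (h : k ≤ n) :
    legCoeff n k = (-1) ^ k * (n + k).factorial / ((k.factorial : ℝ) ^ 2 * (n - k).factorial) := by
  rw [legCoeff, Nat.cast_choose ℝ h, Nat.cast_choose ℝ (Nat.le_add_left k n), Nat.add_sub_cancel]
  have h₁ : (n.factorial : ℝ) ≠ 0 := by positivity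
  field_simp

lemma legCoeff_succ_right (n k : ℕ) :
    ((k : ℝ) + 1) ^ 2 * legCoeff n (k + 1) = -((n - k) * (n + k + 1)) * legCoeff n k := by
  rcases lt_trichotomy n k with h | rfl | h
  · simp [legCoeff_eq_zero h, legCoeff_eq_zero (h.trans k.lt_succ_self)]
  · simp [legCoeff_eq_zero n.lt_succ_self]
  · obtain ⟨m, rfl⟩ := Nat.exists_eq_add_of_lt h
    rw [legCoeff_eq_factorial (Nat.succ_le_of_lt h), legCoeff_eq_factorial h.le,
      show k + m + 1 - (k + 1) = m by omega, show k + m + 1 - k = m + 1 by omega,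
      show k + m + 1 + (k + 1) = k + m + 1 + k + 1 by omega]
    simp only [Nat.factorial_succ (k + m + 1 + k), Nat.factorial_succ k, Nat.factorial_succ m,
      pow_succ]
    push_cast
    field_simp
    ring

lemma legCoeff_succ_left (n k : ℕ) :
    ((n : ℝ) + 1 - k) * legCoeff (n + 1) k = (n + 1 + k) * legCoeff n k := by
  rcases lt_trichotomy (n + 1) k with h | rfl | h
  · simp [legCoeff_eq_zero h, legCoeff_eq_zero (n.lt_succ_self.trans h)]
  · simp [legCoeff_eq_zero n.lt_succ_self]
  · obtain ⟨m, rfl⟩ := Nat.exists_eq_add_of_le (Nat.lt_succ_iff.mp h)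
    rw [legCoeff_eq_factorial h.le, legCoeff_eq_factorial (Nat.le_add_right k m),
      show k + m + 1 - k = m + 1 by omega, show k + m - k = m by omega,
      show k + m + 1 + k = k + m + k + 1 by omega]
    simp only [Nat.factorial_succ (k + m + k), Nat.factorial_succ m]
    push_cast
    field_simp
    ring

lemma legCoeff_sub (n k : ℕ) :
    ((n : ℝ) + 1) * (legCoeff (n + 1) k - legCoeff n k) =
      k * (legCoeff (n + 1) k + legCoeff n k) := by
  linear_combination legCoeff_succ_left n k

lemma legCoeff_add (n k : ℕ) :
    ((n : ℝ) + 1) * (legCoeff (n + 1) k + legCoeff n k) =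
      k * (legCoeff (n + 1) k - legCoeff n k) -
        ((k + 1 : ℕ) : ℝ) * (legCoeff (n + 1) (k + 1) - legCoeff n (k + 1)) := by
  have hk : (k : ℝ) + 1 ≠ 0 := by positivity
  apply mul_left_cancel₀ hk
  have h₁ := legCoeff_succ_right (n + 1) k
  have h₂ := legCoeff_succ_right n k
  have h₃ := legCoeff_succ_left n k
  push_cast at *
  linear_combination h₁ - h₂ - ((n : ℝ) + 1) * h₃

lemma legSum_eq_sum_range (f : ℕ → ℝ) {n N : ℕ} (h : n < N) :
    legSum f n = ∑ k ∈ Finset.range N, legCoeff n k * f k := by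
  refine Finset.sum_subset (Finset.range_mono h) fun k _ hk => ?_
  rw [legCoeff_eq_zero (by simpa using hk), zero_mul]

lemma sum_range_sub_mul_by_parts (f g : ℕ → ℝ) (N : ℕ) :
    ∑ k ∈ Finset.range N, (g k - g (k + 1)) * f k =
      g 0 * f 0 - g N * f N + ∑ k ∈ Finset.range N, g (k + 1) * (f (k + 1) - f k) := by
  induction N with
  | zero => simp
  | succ N ih => rw [Finset.sum_range_succ, Finset.sum_range_succ, ih]; ring

lemma legSum_succ_add (f : ℕ → ℝ) (n : ℕ) :
    ((n : ℝ) + 1) * (legSum f (n + 1) + legSum f n) =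
      ∑ k ∈ Finset.range (n + 2), (legCoeff (n + 1) (k + 1) - legCoeff n (k + 1)) *
        (((k : ℝ) + 1) * (f (k + 1) - f k)) := by
  have h := sum_range_sub_mul_by_parts f
    (fun k => (k : ℝ) * (legCoeff (n + 1) k - legCoeff n k)) (n + 2)
  simp only [← legCoeff_add] at h
  rw [legCoeff_eq_zero (show n + 1 < n + 2 by omega),
    legCoeff_eq_zero (show n < n + 2 by omega)] at h
  rw [legSum_eq_sum_range f (show n + 1 < n + 2 by omega),
    legSum_eq_sum_range f (show n < n + 2 by omega), ← Finset.sum_add_distrib, Finset.mul_sum]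
  convert h using 1
  · exact Finset.sum_congr rfl fun k _ => by ring
  · simp only [Nat.cast_zero, zero_mul, sub_self, mul_zero, zero_add]
    exact Finset.sum_congr rfl fun k _ => by push_cast; ring

lemma sum_range_legCoeff_sub (f : ℕ → ℝ) (n : ℕ) :
    ∑ k ∈ Finset.range (n + 2), (legCoeff (n + 1) (k + 1) - legCoeff n (k + 1)) * f (k + 1) =
      legSum f (n + 1) - legSum f n := by
  rw [legSum_eq_sum_range f (show n + 1 < n + 2 + 1 by omega),
    legSum_eq_sum_range f (show n < n + 2 + 1 by omega), ← Finset.sum_sub_distrib,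
    Finset.sum_range_succ' _ (n + 2)]
  simp only [legCoeff_zero_right, sub_mul, sub_self, add_zero]

lemma legSum_one (n : ℕ) : legSum (fun _ => 1) n = (-1) ^ n := by
  induction n with
  | zero => simp [legSum, legCoeff]
  | succ n ih =>
    have h := legSum_succ_add (fun _ => 1) n
    have hn : (n : ℝ) + 1 ≠ 0 := by positivity
    simp only [sub_self, mul_zero, Finset.sum_const_zero, mul_eq_zero, hn, false_or] at h
    rw [pow_succ]
    linear_combination h - ih

lemma harm_succ (n : ℕ) : harm (n + 1) = harm n + 1 / ((n : ℝ) + 1) :=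
  Finset.sum_range_succ _ _

lemma harm2_succ (n : ℕ) : harm2 (n + 1) = harm2 n + 1 / ((n : ℝ) + 1) ^ 2 :=
  Finset.sum_range_succ _ _

lemma legSum_harm (n : ℕ) : legSum harm n = 2 * (-1) ^ n * harm n := by
  induction n with
  | zero => simp [legSum, harm]
  | succ n ih =>
    have hn : (n : ℝ) + 1 ≠ 0 := by positivity
    have h := legSum_succ_add harm n
    have hk (k : ℕ) : ((k : ℝ) + 1) * (harm (k + 1) - harm k) = 1 := by
      rw [harm_succ]; field_simp; ring
    simp only [hk] at h
    rw [sum_range_legCoeff_sub (fun _ => 1) n, legSum_one, legSum_one, ih] at h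
    apply mul_left_cancel₀ hn
    rw [harm_succ]
    field_simp
    rw [pow_succ] at *
    linear_combination h

lemma sum_range_legCoeff_sub_div (n : ℕ) :
    ∑ k ∈ Finset.range (n + 2),
      (legCoeff (n + 1) (k + 1) - legCoeff n (k + 1)) * (1 / ((k : ℝ) + 1)) =
        -2 / ((n : ℝ) + 1) := by
  have hn : (n : ℝ) + 1 ≠ 0 := by positivity
  have hk (k : ℕ) : (legCoeff (n + 1) (k + 1) - legCoeff n (k + 1)) * (1 / ((k : ℝ) + 1)) =
      (legCoeff (n + 1) (k + 1) * 1 + legCoeff n (k + 1) * 1) / ((n : ℝ) + 1) := by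
    have h := legCoeff_sub n (k + 1)
    push_cast at h
    field_simp
    linear_combination h
  have h₁ := legSum_eq_sum_range (fun _ => 1) (show n + 1 < n + 2 + 1 by omega)
  have h₂ := legSum_eq_sum_range (fun _ => 1) (show n < n + 2 + 1 by omega)
  rw [legSum_one, Finset.sum_range_succ', legCoeff_zero_right] at h₁ h₂
  simp only [hk]
  rw [← Finset.sum_div, Finset.sum_add_distrib]
  congr 1
  rw [pow_succ] at h₁
  linear_combination -h₁ - h₂

lemma legSum_harm_sq_succ_add (n : ℕ) :
    ((n : ℝ) + 1) * (legSum (fun k => harm k ^ 2) (n + 1) + legSum (fun k => harm k ^ 2) n) =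
      2 * (legSum harm (n + 1) - legSum harm n) + 2 / ((n : ℝ) + 1) := by
  have hk (k : ℕ) (c : ℝ) : c * (((k : ℝ) + 1) * (harm (k + 1) ^ 2 - harm k ^ 2)) =
      2 * (c * harm (k + 1)) - c * (1 / ((k : ℝ) + 1)) := by
    rw [harm_succ]; field_simp; ring
  rw [legSum_succ_add]
  simp only [hk]
  rw [Finset.sum_sub_distrib, ← Finset.mul_sum, sum_range_legCoeff_sub,
    sum_range_legCoeff_sub_div]
  ring

lemma harm2_half_succ (n : ℕ) :
    harm2 ((n + 1) / 2) = harm2 (n / 2) + 2 * (1 - (-1) ^ n) / ((n : ℝ) + 1) ^ 2 := by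
  obtain ⟨m, rfl | rfl⟩ := n.even_or_odd'
  · rw [show (2 * m + 1) / 2 = m by omega, show 2 * m / 2 = m by omega]
    simp
  · rw [show (2 * m + 1 + 1) / 2 = m + 1 by omega, show (2 * m + 1) / 2 = m by omega,
      harm2_succ, Odd.neg_one_pow ⟨m, rfl⟩]
    have hm : (m : ℝ) + 1 ≠ 0 := by positivity
    push_cast
    rw [show (2 * (m : ℝ) + 1 + 1) = 2 * (m + 1) by ring]
    field_simp
    ring

lemma legSum_harm_sq (n : ℕ) :
    legSum (fun k => harm k ^ 2) n =
      (-1) ^ n * (4 * harm n ^ 2 - 2 * harm2 n + harm2 (n / 2)) := by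
  induction n with
  | zero => simp [legSum, harm, harm2]
  | succ n ih =>
    have hn : (n : ℝ) + 1 ≠ 0 := by positivity
    have hsq : ((-1 : ℝ) ^ n) ^ 2 = 1 := by rw [← pow_mul, mul_comm, pow_mul]; simp
    have h := legSum_harm_sq_succ_add n
    rw [legSum_harm, legSum_harm, ih, harm_succ] at h
    rw [harm_succ, harm2_succ, harm2_half_succ]
    apply mul_left_cancel₀ hn
    rw [pow_succ] at *
    field_simp at h ⊢
    linear_combination h - 2 * hsq

theorem stmt17 (n : ℕ) :
    ∑ k ∈ Finset.range (n + 1),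
      (-1 : ℝ) ^ k * (n.choose k : ℝ) * ((n + k).choose k : ℝ) * (harm k) ^ 2
    = if n % 2 = 0 then
        (-1 : ℝ) ^ n * (4 * (harm n) ^ 2 - 2 * harm2 n + harm2 (n / 2))
      else
        (-1 : ℝ) ^ n * (4 * (harm n) ^ 2 - 2 * harm2 n + harm2 ((n - 1) / 2)) := by
  have h := legSum_harm_sq n
  simp only [legSum, legCoeff] at h
  rw [h]
  split_ifs with hn
  · rfl
  · rw [show (n - 1) / 2 = n / 2 by omega]
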